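/- arXiv:1709.00121 — 2 statements merged into one kernel-verified Lean document; each statement's English description precedes it below -/
import Mathlib

section
/- Let k be a field of characteristic zero, n ≥ 1, and let J ∈ M_n(k) be the nilpotent Jordan block (ones on the superdiagonal, zeros elsewhere). If B ∈ M_n(k) satisfies JB − BJ = B², then (with 1-based indices) B_{i,j} = 0 for all 1 ≤ j ≤ i ≤ n, and B_{i+1,j+1} − B_{i,j} = Σ_{k=i+1}^{j} B_{i,k}·B_{k,j+1} for all 1 ≤ i < j ≤ n−1. -/
/-- Left multiplication by the nilpotent Jordan block shifts coordinates down by one. -/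
theorem jordanBlock_mulVec {k : Type*} [Field k] {n : ℕ} {J : Matrix (Fin n) (Fin n) k}
    (hJ : ∀ i j : Fin n, J i j = if (i : ℕ) + 1 = (j : ℕ) then 1 else 0)
    (v : Fin n → k) (i : Fin n) :
    J.mulVec v i = if h : (i : ℕ) + 1 < n then v ⟨i + 1, h⟩ else 0 := by
  simp only [Matrix.mulVec, dotProduct, hJ, ite_mul, one_mul, zero_mul]
  split_ifs with h
  · rw [Finset.sum_eq_single (⟨i + 1, h⟩ : Fin n)]
    · simp
    · intro b _ hb
      rw [if_neg]
      intro e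
      exact hb (Fin.ext e.symm)
    · simp
  · refine Finset.sum_eq_zero fun x _ => ?_
    rw [if_neg]
    have := x.2
    omega

/-- A subspace invariant under the nilpotent Jordan block which contains a vector with leading
coordinate `m` contains every vector supported on the coordinates up to `m`. -/
theorem mem_of_jordanBlock_invariant {k : Type*} [Field k] {n : ℕ}
    {J : Matrix (Fin n) (Fin n) k}
    (hJ : ∀ i j : Fin n, J i j = if (i : ℕ) + 1 = (j : ℕ) then 1 else 0)
    (W : Submodule k (Fin n → k)) (hW : ∀ v ∈ W, J.mulVec v ∈ W) (m : ℕ) (hm : m < n)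
    (w : Fin n → k) (hw : w ∈ W) (hw0 : ∀ l : Fin n, m < l → w l = 0) (hwm : w ⟨m, hm⟩ ≠ 0)
    (v : Fin n → k) (hv : ∀ l : Fin n, m < l → v l = 0) : v ∈ W := by
  induction m generalizing w v with
  | zero =>
    have h : v = (v ⟨0, hm⟩ / w ⟨0, hm⟩) • w := by
      ext l
      rcases Nat.eq_zero_or_pos (l : ℕ) with h | h
      · obtain rfl : l = ⟨0, hm⟩ := Fin.ext h
        simp [hwm]
      · simp [hv l h, hw0 l h]
    rw [h]
    exact W.smul_mem _ hw
  | succ m ih =>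
    have h : v - (v ⟨m + 1, hm⟩ / w ⟨m + 1, hm⟩) • w ∈ W := by
      refine ih (by omega) (J.mulVec w) (hW w hw) (fun l hl => ?_) ?_ _ (fun l hl => ?_)
      · rw [jordanBlock_mulVec hJ]
        split_ifs with h
        · exact hw0 _ (Nat.succ_lt_succ hl)
        · rfl
      · rw [jordanBlock_mulVec hJ, dif_pos hm]
        exact hwm
      · rcases Nat.eq_or_lt_of_le (Nat.succ_le_of_lt hl) with h | h
        · obtain rfl : l = ⟨m + 1, hm⟩ := Fin.ext h.symm
          simp [hwm]
        · simp [hv l h, hw0 l h]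
    simpa using W.add_mem h (W.smul_mem (v ⟨m + 1, hm⟩ / w ⟨m + 1, hm⟩) hw)

theorem jordanBlock_isNilpotent {k : Type*} [Field k] {n : ℕ} {J : Matrix (Fin n) (Fin n) k}
    (hJ : ∀ i j : Fin n, J i j = if (i : ℕ) + 1 = (j : ℕ) then 1 else 0) : IsNilpotent J := by
  have key : ∀ (m : ℕ) (v : Fin n → k) (i : Fin n), n ≤ i + m → (J ^ m).mulVec v i = 0 := by
    intro m
    induction m with
    | zero => intro v i h; have := i.2; omega
    | succ m ih =>
      intro v i h
      rw [pow_succ', ← Matrix.mulVec_mulVec, jordanBlock_mulVec hJ]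
      split_ifs with h'
      · exact ih v _ (by simp only; omega)
      · rfl
  refine ⟨n, Matrix.ext_of_mulVec_single fun j => ?_⟩
  ext i
  rw [key n _ i (by omega), Matrix.zero_mulVec, Pi.zero_apply]

theorem commutator_pow_of_commutator_eq_sq {R : Type*} [Ring R] {a b : R}
    (h : a * b - b * a = b ^ 2) (m : ℕ) : a * b ^ m - b ^ m * a = m • b ^ (m + 1) := by
  induction m with
  | zero => simp
  | succ m ih =>
    calc a * b ^ (m + 1) - b ^ (m + 1) * a
        = (a * b ^ m - b ^ m * a) * b + b ^ m * (a * b - b * a) := by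
          rw [pow_succ]; noncomm_ring
      _ = (m + 1) • b ^ (m + 1 + 1) := by
          rw [ih, h, smul_mul_assoc, ← pow_succ, ← pow_add, add_smul, one_smul]

/-- In characteristic zero, `ab - ba = b²` with `a` nilpotent forces `b` to be nilpotent. -/
theorem isNilpotent_of_commutator_eq_sq {k A : Type*} [Field k] [CharZero k] [Ring A]
    [Algebra k A] {a b : A} (ha : IsNilpotent a) (h : a * b - b * a = b ^ 2) :
    IsNilpotent b := by
  obtain ⟨N, hN⟩ : IsNilpotent (LinearMap.mulLeft k a - LinearMap.mulRight k a) :=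
    (LinearMap.commute_mulLeft_right a a).isNilpotent_sub
      ((LinearMap.isNilpotent_mulLeft_iff k a).mpr ha)
      ((LinearMap.isNilpotent_mulRight_iff k a).mpr ha)
  have key : ∀ m : ℕ, ((LinearMap.mulLeft k a - LinearMap.mulRight k a) ^ m) b =
      (m.factorial : k) • b ^ (m + 1) := by
    intro m
    induction m with
    | zero => simp
    | succ m ih =>
      rw [pow_succ', Module.End.mul_apply, ih, map_smul, LinearMap.sub_apply,
        LinearMap.mulLeft_apply, LinearMap.mulRight_apply,
        commutator_pow_of_commutator_eq_sq h, ← Nat.cast_smul_eq_nsmul k, smul_smul,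
        Nat.factorial_succ, Nat.cast_mul, mul_comm]
  have h0 := key N
  rw [hN, LinearMap.zero_apply] at h0
  exact ⟨N + 1, (smul_eq_zero.mp h0.symm).resolve_left
    (Nat.cast_ne_zero.mpr N.factorial_ne_zero)⟩

theorem strictly_upper_of_commutator_eq_sq {k : Type*} [Field k] [CharZero k] {n : ℕ}
    {J B : Matrix (Fin n) (Fin n) k}
    (hJ : ∀ i j : Fin n, J i j = if (i : ℕ) + 1 = (j : ℕ) then 1 else 0)
    (hB : J * B - B * J = B ^ 2) (i j : Fin n) (hij : j ≤ i) : B i j = 0 := by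
  classical
  by_contra hne
  obtain ⟨N, hN⟩ := isNilpotent_of_commutator_eq_sq (k := k) (jordanBlock_isNilpotent hJ) hB
  have hex : ∃ m, (B ^ m).mulVec (Pi.single j 1) = 0 := ⟨N, by rw [hN, Matrix.zero_mulVec]⟩
  obtain ⟨m, hm⟩ : ∃ m, Nat.find hex = m + 1 := by
    refine Nat.exists_eq_succ_of_ne_zero fun h => ?_
    have := Nat.find_spec hex
    rw [h, pow_zero, Matrix.one_mulVec, Pi.single_eq_zero_iff] at this
    exact one_ne_zero this
  have hlast : (B ^ m).mulVec (B.mulVec (Pi.single j 1)) = 0 := by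
    rw [Matrix.mulVec_mulVec, ← pow_succ, ← hm]
    exact Nat.find_spec hex
  refine Nat.find_min hex (m := m) (by omega) ?_
  obtain ⟨t, ht, hmax⟩ := Finset.exists_max_image
    (Finset.univ.filter fun l => B l j ≠ 0) id ⟨i, by simpa using hne⟩
  have hcol : ∀ l, B.mulVec (Pi.single j 1) l = B l j := by simp
  have hinv : ∀ v ∈ LinearMap.ker (B ^ m).mulVecLin,
      J.mulVec v ∈ LinearMap.ker (B ^ m).mulVecLin := by
    intro v hv
    rw [LinearMap.mem_ker, Matrix.mulVecLin_apply] at hv ⊢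
    have hc := congrArg (fun M => M.mulVec v) (commutator_pow_of_commutator_eq_sq hB m)
    simpa [Matrix.sub_mulVec, ← Matrix.mulVec_mulVec, pow_succ', hv, Matrix.smul_mulVec] using hc
  have hmem := mem_of_jordanBlock_invariant hJ (LinearMap.ker (B ^ m).mulVecLin) hinv t t.2
    (B.mulVec (Pi.single j 1)) (by simpa using hlast)
    (fun l hl => by
      rw [hcol]
      by_contra h
      exact absurd (hmax l (by simpa using h)) (not_le.mpr hl))
    (by rw [hcol]; simpa using ht) (Pi.single j 1)
    (fun l hl => by
      have hjt : j ≤ t := hij.trans (hmax i (by simpa using hne))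
      exact Pi.single_eq_of_ne (hjt.trans_lt hl).ne' 1)
  simpa using hmem

theorem stmt_13 (k : Type*) [Field k] [CharZero k] (n : ℕ) (hn : 1 ≤ n)
    (J B : Matrix (Fin n) (Fin n) k)
    (hJ : ∀ i j : Fin n, J i j = if (i : ℕ) + 1 = (j : ℕ) then 1 else 0)
    (hB : J * B - B * J = B ^ 2) :
    (∀ i j : Fin n, j ≤ i → B i j = 0) ∧
    (∀ i j : ℕ, (hij : i < j) → (hj : j + 1 < n) →
      B ⟨i + 1, by omega⟩ ⟨j + 1, hj⟩ - B ⟨i, by omega⟩ ⟨j, by omega⟩ =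
        ∑ l ∈ Finset.Ioc (⟨i, by omega⟩ : Fin n) ⟨j, by omega⟩,
          B ⟨i, by omega⟩ l * B l ⟨j + 1, hj⟩) := by
  have hup := strictly_upper_of_commutator_eq_sq hJ hB
  refine ⟨hup, fun i j hij hj => ?_⟩
  have hi : i < n := by omega
  have hi' : i + 1 < n := by omega
  have hj' : j < n := by omega
  have hJB : (J * B) ⟨i, hi⟩ ⟨j + 1, hj⟩ = B ⟨i + 1, hi'⟩ ⟨j + 1, hj⟩ := by
    have := jordanBlock_mulVec hJ (fun l => B l ⟨j + 1, hj⟩) ⟨i, hi⟩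
    rw [dif_pos hi'] at this
    exact this
  have hBJ : (B * J) ⟨i, hi⟩ ⟨j + 1, hj⟩ = B ⟨i, hi⟩ ⟨j, hj'⟩ := by
    rw [Matrix.mul_apply, Finset.sum_eq_single (⟨j, hj'⟩ : Fin n)]
    · simp [hJ]
    · intro l _ hl
      rw [hJ, if_neg, mul_zero]
      intro e
      exact hl (Fin.ext (Nat.succ.inj e))
    · simp
  have h := congrFun (congrFun hB ⟨i, hi⟩) ⟨j + 1, hj⟩
  rw [Matrix.sub_apply, hJB, hBJ, pow_two, Matrix.mul_apply] at h
  rw [h]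
  refine (Finset.sum_subset (Finset.subset_univ _) fun l _ hl => ?_).symm
  rw [Finset.mem_Ioc, not_and_or, not_lt, not_le] at hl
  rcases hl with hl | hl
  · rw [hup _ _ hl, zero_mul]
  · rw [hup l ⟨j + 1, hj⟩ hl, mul_zero]
end

section
/- Let k be a field of characteristic zero, n ≥ 2, and let J ∈ M_n(k) be the nilpotent Jordan block (ones on the superdiagonal, zeros elsewhere). Let B ∈ M_n(k) satisfy JB − BJ = B², and let S ∈ M_n(k) be invertible with SJ = JS. Then: (1) if B_{n−1,n} ≠ 0, then (S⁻¹BS)_{n−1,n} = B_{n−1,n} and (S⁻¹BS)_{n,n} = B_{n,n}; (2) if there is an integer i with 2 ≤ i ≤ ⌊(n−1)/2⌋ such that B_{n−j,n} = 0 for all 1 ≤ j ≤ i−1 and B_{n−i,n} ≠ 0, then (S⁻¹BS)_{j,n} = B_{j,n} for all n−2i+1 ≤ j ≤ n. -/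
section JordanPlane

variable {k V : Type*} [Field k] [AddCommGroup V] [Module k V]

open Module (End)

/-- In characteristic zero, if `X` is nilpotent and `[X, p] = p²`, then `p` is nilpotent. -/
theorem isNilpotent_of_commutator_eq_sq_s18 [CharZero k] {A : Type*} [Ring A] [Algebra k A] {X p : A}
    (hX : IsNilpotent X) (hp : X * p - p * X = p ^ 2) : IsNilpotent p := by
  have hpow : ∀ m : ℕ, X * p ^ m - p ^ m * X = (m : A) * p ^ (m + 1) := by
    intro m
    induction m with
    | zero => simp
    | succ m ih =>
      have h : X * p ^ (m + 1) - p ^ (m + 1) * X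
          = (X * p ^ m - p ^ m * X) * p + p ^ m * (X * p - p * X) := by
        rw [pow_succ]; noncomm_ring
      rw [h, ih, hp, mul_assoc, ← pow_succ, ← pow_add]
      push_cast
      noncomm_ring
  have had : ∀ m : ℕ, ((LinearMap.mulLeft k X - LinearMap.mulRight k X) ^ m) p
      = (m.factorial : k) • p ^ (m + 1) := by
    intro m
    induction m with
    | zero => simp
    | succ m ih =>
      rw [pow_succ', Module.End.mul_apply, ih, map_smul, LinearMap.sub_apply,
        LinearMap.mulLeft_apply, LinearMap.mulRight_apply, hpow,
        ← nsmul_eq_mul, ← Nat.cast_smul_eq_nsmul k, smul_smul, ← Nat.cast_mul,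
        Nat.factorial_succ, mul_comm]
  obtain ⟨m, hm⟩ : IsNilpotent (LinearMap.mulLeft k X - LinearMap.mulRight k X) :=
    (LinearMap.commute_mulLeft_right X X).isNilpotent_sub
      ((LinearMap.isNilpotent_mulLeft_iff k X).mpr hX)
      ((LinearMap.isNilpotent_mulRight_iff k X).mpr hX)
  refine ⟨m + 1, ?_⟩
  have h := had m
  rw [hm, LinearMap.zero_apply] at h
  exact (smul_eq_zero.mp h.symm).resolve_left (Nat.cast_ne_zero.mpr m.factorial_ne_zero)

theorem range_pow_succ_le (X : End k V) (a : ℕ) : (X ^ (a + 1)).range ≤ (X ^ a).range := by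
  rintro _ ⟨v, rfl⟩
  exact ⟨X v, by rw [pow_succ, Module.End.mul_apply]⟩

theorem apply_mem_range_pow_succ {X : End k V} {a : ℕ} {v : V} (hv : v ∈ (X ^ a).range) :
    X v ∈ (X ^ (a + 1)).range := by
  obtain ⟨w, rfl⟩ := hv
  exact ⟨w, by rw [pow_succ', Module.End.mul_apply]⟩

theorem apply_mem_range_pow_of_commute {X T : End k V} (hT : Commute T X) {a : ℕ} {v : V}
    (hv : v ∈ (X ^ a).range) : T v ∈ (X ^ a).range := by
  obtain ⟨w, rfl⟩ := hv
  exact ⟨T w, by rw [← Module.End.mul_apply, ← Module.End.mul_apply, (hT.pow_right a).eq]⟩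

theorem exists_smul_sub_mem_range_pow_succ {X : End k V} {e : V}
    (he : ∀ v, ∃ c : k, v - c • e ∈ X.range) {a : ℕ} {v : V} (hv : v ∈ (X ^ a).range) :
    ∃ c : k, v - c • (X ^ a) e ∈ (X ^ (a + 1)).range := by
  obtain ⟨w, rfl⟩ := hv
  obtain ⟨c, u, hu⟩ := he w
  exact ⟨c, u, by rw [pow_succ, Module.End.mul_apply, hu, map_sub, map_smul]⟩

/-- If `X` is nilpotent and the range of `X ^ a` is contained in an `X`-stable `U` modulo the range
of `X ^ (a + 1)`, then it is contained in `U`. -/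
theorem range_pow_le_of_le_sup {X : End k V} (hX : IsNilpotent X) {U : Submodule k V}
    (hU : ∀ u ∈ U, X u ∈ U) {a : ℕ} (h : (X ^ a).range ≤ U ⊔ (X ^ (a + 1)).range) :
    (X ^ a).range ≤ U := by
  have hstep : ∀ t, (X ^ a).range ≤ U ⊔ (X ^ (a + t)).range := by
    have hshift : ∀ t, (X ^ (a + t)).range ≤ U ⊔ (X ^ (a + t + 1)).range := by
      intro t
      induction t with
      | zero => exact h
      | succ t ih =>
        rintro _ ⟨v, rfl⟩
        obtain ⟨u, hu, w, hw, huw⟩ := Submodule.mem_sup.mp (ih ⟨v, rfl⟩)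
        refine Submodule.mem_sup.mpr ⟨X u, hU u hu, X w, apply_mem_range_pow_succ hw, ?_⟩
        rw [← map_add, huw, ← add_assoc, pow_succ', Module.End.mul_apply]
    intro t
    induction t with
    | zero => exact le_sup_right
    | succ t ih => exact ih.trans (sup_le le_sup_left (hshift t))
  obtain ⟨m, hm⟩ := hX
  have := hstep m
  rwa [pow_add, hm, mul_zero, LinearMap.range_zero, sup_bot_eq] at this

variable {X p : End k V} {e : V}

/-- A nilpotent `p` with `[X, p] = p²` is strictly triangular for the flag of a nilpotent `X`
with one-dimensional cokernel. -/
theorem apply_mem_range_pow_succ_of_commutator_eq_sq (hX : IsNilpotent X)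
    (hnil : IsNilpotent p) (hp : ∀ v, X (p v) = p (X v) + p (p v))
    (he : ∀ v, ∃ c : k, v - c • e ∈ X.range) (a : ℕ) :
    ∀ v ∈ (X ^ a).range, p v ∈ (X ^ (a + 1)).range := by
  have key : ∀ a, (∀ v ∈ (X ^ a).range, p v ∈ (X ^ a).range) →
      ∀ v ∈ (X ^ a).range, p v ∈ (X ^ (a + 1)).range := by
    intro a hstab v hv
    by_contra hpv
    have hXa : ∀ w ∈ (X ^ a).range, X w ∈ (X ^ a).range := fun w hw =>
      range_pow_succ_le X a (apply_mem_range_pow_succ hw)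
    have hle : (X ^ a).range ≤ (X ^ a).range.map p := by
      refine range_pow_le_of_le_sup hX ?_ ?_
      · rintro _ ⟨w, hw, rfl⟩
        exact ⟨X w + p w, add_mem (hXa w hw) (hstab w hw), by rw [map_add, hp]⟩
      · intro w hw
        obtain ⟨c, hc⟩ := exists_smul_sub_mem_range_pow_succ he (hstab v hv)
        obtain ⟨d, hd⟩ := exists_smul_sub_mem_range_pow_succ he hw
        have hc0 : c ≠ 0 := by
          rintro rfl
          exact hpv (by simpa using hc)
        refine Submodule.mem_sup.mpr ⟨(d * c⁻¹) • p v, Submodule.smul_mem _ _ ⟨v, hv, rfl⟩,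
          w - (d * c⁻¹) • p v, ?_, by abel⟩
        have : w - (d * c⁻¹) • p v = (w - d • (X ^ a) e)
            - (d * c⁻¹) • (p v - c • (X ^ a) e) := by
          rw [smul_sub, smul_smul, inv_mul_cancel_right₀ hc0]
          abel
        rw [this]
        exact sub_mem hd (Submodule.smul_mem _ _ hc)
    have hpow : ∀ m, ∀ w ∈ (X ^ a).range, ∃ u ∈ (X ^ a).range, (p ^ m) u = w := by
      intro m
      induction m with
      | zero => exact fun w hw => ⟨w, hw, by simp⟩
      | succ m ih =>
        intro w hw
        obtain ⟨u, hu, rfl⟩ := ih w hw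
        obtain ⟨u', hu', rfl⟩ := hle hu
        exact ⟨u', hu', by rw [pow_succ, Module.End.mul_apply]⟩
    obtain ⟨m, hm⟩ := hnil
    obtain ⟨u, -, hu⟩ := hpow m (p v) (hstab v hv)
    rw [hm, LinearMap.zero_apply] at hu
    exact hpv (hu ▸ zero_mem _)
  induction a with
  | zero => exact key 0 fun v _ => ⟨p v, by simp⟩
  | succ a ih => exact key (a + 1) fun v hv => ih v (range_pow_succ_le X a hv)

/-- If `p e` lies in step `i` of the flag, then `p` raises the flag by `i`. -/
theorem apply_mem_range_pow_add (hX : IsNilpotent X)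
    (hp : ∀ v, X (p v) = p (X v) + p (p v)) (he : ∀ v, ∃ c : k, v - c • e ∈ X.range)
    (htri : ∀ a, ∀ v ∈ (X ^ a).range, p v ∈ (X ^ (a + 1)).range) {i : ℕ}
    (hpe : p e ∈ (X ^ i).range) (a : ℕ) : ∀ v ∈ (X ^ a).range, p v ∈ (X ^ (a + i)).range := by
  have hbasis : ∀ j, p ((X ^ j) e) ∈ (X ^ (j + i)).range := by
    intro j
    induction j with
    | zero => simpa using hpe
    | succ j ih =>
      rw [pow_succ', Module.End.mul_apply, eq_sub_of_add_eq (hp ((X ^ j) e)).symm,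
        Nat.add_right_comm]
      exact sub_mem (apply_mem_range_pow_succ ih) (htri _ _ ih)
  obtain ⟨n, hn⟩ := hX
  have hdown : ∀ t a, n ≤ a + t → ∀ v ∈ (X ^ a).range, p v ∈ (X ^ (a + i)).range := by
    intro t
    induction t with
    | zero =>
      intro a ha v hv
      rw [pow_eq_zero_of_le (by simpa using ha) hn] at hv
      obtain ⟨w, rfl⟩ := hv
      simp
    | succ t ih =>
      intro a ha v hv
      obtain ⟨c, hc⟩ := exists_smul_sub_mem_range_pow_succ he hv
      have h1 := ih (a + 1) (by omega) _ hc
      rw [Nat.add_right_comm] at h1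
      have h2 := add_mem (range_pow_succ_le X _ h1) (Submodule.smul_mem _ c (hbasis a))
      rwa [map_sub, map_smul, sub_add_cancel] at h2
  exact hdown n a (by omega)

/-- An endomorphism commuting with `X` and killing a cyclic vector vanishes. -/
theorem eq_zero_of_commute_of_apply_eq_zero (hX : IsNilpotent X)
    (he : ∀ v, ∃ c : k, v - c • e ∈ X.range) {T : End k V} (hT : Commute T X) (hTe : T e = 0) :
    T = 0 := by
  have h : ∀ m, ∀ v, T v ∈ (X ^ m).range := by
    intro m
    induction m with
    | zero => exact fun v => ⟨T v, by simp⟩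
    | succ m ih =>
      intro v
      obtain ⟨c, w, hw⟩ := he v
      have hv : T v = X (T w) := by
        rw [← Module.End.mul_apply X T, ← hT.eq, Module.End.mul_apply, hw, map_sub, map_smul, hTe,
          smul_zero, sub_zero]
      exact hv ▸ apply_mem_range_pow_succ (ih w)
  obtain ⟨n, hn⟩ := hX
  ext v
  obtain ⟨w, hw⟩ := h n v
  rw [← hw, hn, LinearMap.zero_apply, LinearMap.zero_apply]

/-- On the cyclic vector, `p` commutes with the centralizer of `X` up to step `2 * i`. -/
theorem apply_apply_sub_mem_range_pow_two_mul (hX : IsNilpotent X)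
    (hp : ∀ v, X (p v) = p (X v) + p (p v)) (he : ∀ v, ∃ c : k, v - c • e ∈ X.range) {i : ℕ}
    (hraise : ∀ a, ∀ v ∈ (X ^ a).range, p v ∈ (X ^ (a + i)).range) {T : End k V}
    (hT : Commute T X) : p (T e) - T (p e) ∈ (X ^ (2 * i)).range := by
  have hsq : ∀ v, p (p v) ∈ (X ^ (2 * i)).range := by
    intro v
    have h := hraise _ _ (hraise 0 v ⟨v, by simp⟩)
    rwa [zero_add, ← two_mul] at h
  have hbasis : ∀ j, p ((X ^ j) e) - (X ^ j) (p e) ∈ (X ^ (2 * i)).range := by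
    intro j
    induction j with
    | zero => simp
    | succ j ih =>
      have h : p ((X ^ (j + 1)) e) - (X ^ (j + 1)) (p e)
          = X (p ((X ^ j) e) - (X ^ j) (p e)) - p (p ((X ^ j) e)) := by
        rw [pow_succ', Module.End.mul_apply, Module.End.mul_apply, map_sub, hp]
        abel
      rw [h]
      exact sub_mem (apply_mem_range_pow_of_commute (Commute.refl X) ih) (hsq _)
  obtain ⟨n, hn⟩ := id hX
  have hdown : ∀ t a, n ≤ a + t → ∀ T : End k V, Commute T X → T e ∈ (X ^ a).range →
      p (T e) - T (p e) ∈ (X ^ (2 * i)).range := by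
    intro t
    induction t with
    | zero =>
      intro a ha T hT hTe
      rw [pow_eq_zero_of_le (by simpa using ha) hn] at hTe
      obtain ⟨w, hw⟩ := hTe
      rw [eq_zero_of_commute_of_apply_eq_zero hX he hT hw.symm]
      simp
    | succ t ih =>
      intro a ha T hT hTe
      obtain ⟨c, hc⟩ := exists_smul_sub_mem_range_pow_succ he hTe
      have h1 := ih (a + 1) (by omega) (T - c • X ^ a)
        (hT.sub_left (((Commute.refl X).pow_left a).smul_left c)) hc
      have h2 := add_mem h1 (Submodule.smul_mem _ c (hbasis a))
      convert h2 using 1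
      simp only [LinearMap.sub_apply, LinearMap.smul_apply, map_sub, map_smul, smul_sub]
      abel
  exact hdown n 0 (by omega) T hT ⟨T e, by simp⟩

end JordanPlane

section JordanBlock

variable {k : Type*} [Field k] {n : ℕ} {J : Matrix (Fin n) (Fin n) k}

theorem jordanBlock_pow_apply (hJ : ∀ i j : Fin n, J i j = if (i : ℕ) + 1 = (j : ℕ) then 1 else 0)
    (a : ℕ) (i j : Fin n) : (J ^ a) i j = if (i : ℕ) + a = (j : ℕ) then 1 else 0 := by
  induction a generalizing i with
  | zero => simp [Matrix.one_apply, Fin.ext_iff]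
  | succ a ih =>
    rw [pow_succ', Matrix.mul_apply]
    simp_rw [ih, hJ]
    by_cases h : (i : ℕ) + 1 < n
    · rw [Finset.sum_eq_single ⟨i + 1, h⟩]
      · simp [add_assoc, add_comm 1 a]
      · intro b _ hb
        rw [if_neg (fun hib => hb (Fin.ext hib.symm)), zero_mul]
      · simp
    · rw [if_neg (by omega)]
      exact Finset.sum_eq_zero fun b _ => by rw [if_neg (by omega), zero_mul]

/-- The range of `J ^ a` consists of the vectors whose last `a` coordinates vanish. -/
theorem mem_range_jordanBlock_pow_iff
    (hJ : ∀ i j : Fin n, J i j = if (i : ℕ) + 1 = (j : ℕ) then 1 else 0) (a : ℕ) (v : Fin n → k) :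
    v ∈ ((Matrix.toLinAlgEquiv' J) ^ a).range ↔ ∀ j : Fin n, n ≤ j + a → v j = 0 := by
  rw [← map_pow]
  simp only [LinearMap.mem_range, Matrix.toLinAlgEquiv'_apply]
  constructor
  · rintro ⟨w, rfl⟩ j hj
    rw [Matrix.mulVec, dotProduct]
    refine Finset.sum_eq_zero fun b _ => ?_
    rw [jordanBlock_pow_apply hJ, if_neg (by omega), zero_mul]
  · intro h
    refine ⟨fun j => if h : a ≤ j then v ⟨j - a, by omega⟩ else 0, ?_⟩
    ext j
    simp only [Matrix.mulVec, dotProduct, jordanBlock_pow_apply hJ]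
    by_cases hj : (j : ℕ) + a < n
    · rw [Finset.sum_eq_single ⟨j + a, hj⟩]
      · simp
      · intro b _ hb
        rw [if_neg (fun hjb => hb (Fin.ext hjb.symm)), zero_mul]
      · simp
    · rw [h j (by omega)]
      exact Finset.sum_eq_zero fun b _ => by rw [if_neg (by omega), zero_mul]

/-- Conjugation by the stabilizer of `J` fixes the bottom `2 * i` entries of the last column
of `B`, if the bottom `i` entries of that column, the last one excepted, vanish. -/
theorem conj_apply_last_eq [CharZero k] (hn : 0 < n) {B S : Matrix (Fin n) (Fin n) k}
    (hJ : ∀ i j : Fin n, J i j = if (i : ℕ) + 1 = (j : ℕ) then 1 else 0)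
    (hB : J * B - B * J = B ^ 2) (hS : IsUnit S) (hSJ : S * J = J * S) {i : ℕ}
    (hzero : ∀ j : Fin n, n ≤ j + i → (j : ℕ) + 1 < n → B j ⟨n - 1, by omega⟩ = 0)
    (j : Fin n) (hj : n ≤ j + 2 * i) :
    (S⁻¹ * B * S) j ⟨n - 1, by omega⟩ = B j ⟨n - 1, by omega⟩ := by
  set l : Fin n := ⟨n - 1, by omega⟩ with hl
  set X := Matrix.toLinAlgEquiv' J with hXdef
  set p := Matrix.toLinAlgEquiv' B with hpdef
  set e : Fin n → k := Pi.single l 1 with hedef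
  have hcol : ∀ M : Matrix (Fin n) (Fin n) k, Matrix.toLinAlgEquiv' M e = fun a => M a l := by
    intro M
    rw [Matrix.toLinAlgEquiv'_apply, hedef, Matrix.mulVec_single_one]
    rfl
  have hX : IsNilpotent X := by
    refine ⟨n, ?_⟩
    rw [hXdef, ← map_pow, show J ^ n = 0 from ?_, map_zero]
    ext a b
    rw [jordanBlock_pow_apply hJ, if_neg (by omega), Matrix.zero_apply]
  have hcomm : X * p - p * X = p ^ 2 := by
    rw [hXdef, hpdef, ← map_mul, ← map_mul, ← map_sub, hB, map_pow]
  have hp : ∀ v, X (p v) = p (X v) + p (p v) := by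
    intro v
    have h := LinearMap.congr_fun (sub_eq_iff_eq_add'.mp hcomm) v
    simpa [pow_two] using h
  have he : ∀ v, ∃ c : k, v - c • e ∈ X.range := by
    intro v
    refine ⟨v l, ?_⟩
    rw [← pow_one X, mem_range_jordanBlock_pow_iff hJ]
    intro a ha
    have : a = l := Fin.ext (by simp only [hl]; omega)
    simp [this, hedef]
  have htri := apply_mem_range_pow_succ_of_commutator_eq_sq hX
    (isNilpotent_of_commutator_eq_sq_s18 (k := k) hX hcomm) hp he
  have hpe : p e ∈ (X ^ i).range := by
    rw [mem_range_jordanBlock_pow_iff hJ, hcol]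
    intro a ha
    by_cases hal : (a : ℕ) + 1 < n
    · exact hzero a ha hal
    · have h := htri 0 e ⟨e, by simp⟩
      rw [mem_range_jordanBlock_pow_iff hJ, hcol] at h
      exact h a (by omega)
  have hmem := apply_apply_sub_mem_range_pow_two_mul hX hp he
    (apply_mem_range_pow_add hX hp he htri hpe) (T := Matrix.toLinAlgEquiv' S)
    (by rw [commute_iff_eq, hXdef, ← map_mul, hSJ, map_mul])
  have hdet := (Matrix.isUnit_iff_isUnit_det S).mp hS
  have hSinv : S⁻¹ * J = J * S⁻¹ := by
    calc S⁻¹ * J = S⁻¹ * (J * S) * S⁻¹ := by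
          rw [mul_assoc, mul_assoc, Matrix.mul_nonsing_inv _ hdet, mul_one]
      _ = J * S⁻¹ := by
          rw [← hSJ, ← mul_assoc, Matrix.nonsing_inv_mul _ hdet, one_mul]
  have hconj := apply_mem_range_pow_of_commute (T := Matrix.toLinAlgEquiv' S⁻¹)
    (by rw [commute_iff_eq, hXdef, ← map_mul, hSinv, map_mul]) hmem
  have hcalc : Matrix.toLinAlgEquiv' S⁻¹ (p (Matrix.toLinAlgEquiv' S e)
        - Matrix.toLinAlgEquiv' S (p e))
      = Matrix.toLinAlgEquiv' (S⁻¹ * B * S - B) e := by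
    simp only [hpdef, ← Module.End.mul_apply, ← map_mul, ← LinearMap.sub_apply, ← map_sub]
    rw [mul_sub, ← mul_assoc, ← mul_assoc, Matrix.nonsing_inv_mul _ hdet, one_mul]
  rw [hcalc, mem_range_jordanBlock_pow_iff hJ, hcol] at hconj
  exact sub_eq_zero.mp (hconj j hj)

end JordanBlock


theorem stmt_18 (k : Type*) [Field k] [CharZero k] (n : ℕ) (hn : 2 ≤ n)
    (J B S : Matrix (Fin n) (Fin n) k)
    (hJ : ∀ i j : Fin n, J i j = if (i : ℕ) + 1 = (j : ℕ) then 1 else 0)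
    (hB : J * B - B * J = B ^ 2)
    (hS : IsUnit S) (hSJ : S * J = J * S) :
    (B ⟨n - 2, by omega⟩ ⟨n - 1, by omega⟩ ≠ 0 →
      (S⁻¹ * B * S) ⟨n - 2, by omega⟩ ⟨n - 1, by omega⟩ =
          B ⟨n - 2, by omega⟩ ⟨n - 1, by omega⟩ ∧
      (S⁻¹ * B * S) ⟨n - 1, by omega⟩ ⟨n - 1, by omega⟩ =
          B ⟨n - 1, by omega⟩ ⟨n - 1, by omega⟩) ∧
    (∀ (i : ℕ) (hi1 : 2 ≤ i) (hi2 : i ≤ (n - 1) / 2)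
        (hzero : ∀ j : ℕ, 1 ≤ j → j ≤ i - 1 →
          B ⟨n - j - 1, by omega⟩ ⟨n - 1, by omega⟩ = 0)
        (hne : B ⟨n - i - 1, by omega⟩ ⟨n - 1, by omega⟩ ≠ 0)
        (j : ℕ) (hj1 : n - 2 * i + 1 ≤ j) (hj2 : j ≤ n),
      (S⁻¹ * B * S) ⟨j - 1, by omega⟩ ⟨n - 1, by omega⟩ =
        B ⟨j - 1, by omega⟩ ⟨n - 1, by omega⟩) := by
  constructor
  · intro _
    have h := conj_apply_last_eq (by omega) hJ hB hS hSJ (i := 1)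
      (fun j h1 h2 => absurd h1 (by omega))
    exact ⟨h _ (by simp only; omega), h _ (by simp only; omega)⟩
  · intro i hi1 hi2 hzero _ j hj1 hj2
    refine conj_apply_last_eq (by omega) hJ hB hS hSJ (i := i) ?_ _
      (by simp only; omega)
    intro a h1 h2
    have h := hzero (n - 1 - a) (by omega) (by omega)
    convert h using 2
    exact Fin.ext (by simp only; omega)
end
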